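/- For every nonnegative integer t, the X-tree X(9 + 12t, 8 + 12t, 5 + 12t, 3), i.e., the starlike tree S(9 + 12t, 8 + 12t, 5 + 12t, 3), is transmission irregular. -/

import Mathlib

/-- The transmission of a vertex: sum of distances to all other vertices. -/
noncomputable def transmission {V : Type*} [Fintype V] (G : SimpleGraph V) (u : V) : ℕ :=
  ∑ v : V, G.dist u v

/-- A graph is transmission irregular if all vertices have distinct transmissions. -/
def TransmissionIrregular {V : Type*} [Fintype V] (G : SimpleGraph V) : Prop :=
  Function.Injective (transmission G)

/-- The starlike tree `S(A 0, …, A (k-1))`: a central vertex (`none`) with `k`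
pendent paths attached, the `i`-th of length `A i`; `some ⟨i, j⟩` is the
`(j+1)`-st vertex on the `i`-th pendent path. -/
def starlikeTree (k : ℕ) (A : Fin k → ℕ) :
    SimpleGraph (Option ((i : Fin k) × Fin (A i))) :=
  SimpleGraph.fromRel (fun x y =>
    match x, y with
    | none, some ⟨_, j⟩ => j.val = 0
    | some ⟨i, j⟩, some ⟨i', j'⟩ => i.val = i'.val ∧ j.val + 1 = j'.val
    | _, _ => False)

namespace SimpleGraph

/-- A function that vanishes at `u`, grows by at most one along each edge, and decreases by one
along some edge at every other vertex is the distance from `u`. -/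
theorem dist_eq_of_potential {V : Type*} {G : SimpleGraph V} {u : V} (f : V → ℕ)
    (h_zero : f u = 0) (h_adj : ∀ v w, G.Adj v w → f w ≤ f v + 1)
    (h_desc : ∀ v, v ≠ u → ∃ w, G.Adj w v ∧ f v = f w + 1) (v : V) :
    G.dist u v = f v := by
  have upper : ∀ n v, f v = n → ∃ p : G.Walk u v, p.length = n := by
    intro n
    induction n with
    | zero =>
      intro v hv
      by_cases hvu : v = u
      · subst hvu
        exact ⟨Walk.nil, rfl⟩
      · obtain ⟨w, -, hw⟩ := h_desc v hvu
        omega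
    | succ n ih =>
      intro v hv
      have hvu : v ≠ u := by
        rintro rfl
        omega
      obtain ⟨w, hwv, hw⟩ := h_desc v hvu
      obtain ⟨p, hp⟩ := ih w (by omega)
      exact ⟨p.concat hwv, by rw [Walk.length_concat, hp]⟩
  have lower : ∀ {a b : V} (p : G.Walk a b), f b ≤ f a + p.length := by
    intro a b p
    induction p with
    | nil => simp
    | cons h p ih =>
      have := h_adj _ _ h
      rw [Walk.length_cons]
      omega
  obtain ⟨p, hp⟩ := upper (f v) v rfl
  obtain ⟨q, hq⟩ := p.reachable.exists_walk_length_eq_dist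
  have h₁ := dist_le p
  have h₂ := lower q
  omega

end SimpleGraph

section Starlike

variable {k : ℕ} {A : Fin k → ℕ}

theorem starlikeTree_adj_none_some (i : Fin k) (j : Fin (A i)) :
    (starlikeTree k A).Adj none (some ⟨i, j⟩) ↔ j.val = 0 := by
  simp [starlikeTree, SimpleGraph.fromRel_adj]

theorem starlikeTree_adj_some_some (i i' : Fin k) (j : Fin (A i)) (j' : Fin (A i')) :
    (starlikeTree k A).Adj (some ⟨i, j⟩) (some ⟨i', j'⟩) ↔
      i = i' ∧ (j.val + 1 = j'.val ∨ j'.val + 1 = j.val) := by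
  rw [starlikeTree, SimpleGraph.fromRel_adj]
  constructor
  · rintro ⟨-, h | h⟩
    · exact ⟨Fin.ext h.1, Or.inl h.2⟩
    · exact ⟨Fin.ext h.1.symm, Or.inr h.2⟩
  · rintro ⟨rfl, h⟩
    refine ⟨?_, h.imp (fun h => ⟨rfl, h⟩) (fun h => ⟨rfl, h⟩)⟩
    intro e
    simp only [Option.some.injEq, Sigma.mk.injEq, heq_eq_eq, true_and] at e
    subst e
    omega

theorem starlikeTree_adj_pred (i : Fin k) (j : Fin (A i)) (hj : j.val ≠ 0) :
    (starlikeTree k A).Adj (some ⟨i, ⟨j.val - 1, by omega⟩⟩) (some ⟨i, j⟩) :=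
  (starlikeTree_adj_some_some ..).2 ⟨rfl, Or.inl (by simp only; omega)⟩

theorem starlikeTree_adj_succ (i : Fin k) (j : Fin (A i)) (hj : j.val + 1 < A i) :
    (starlikeTree k A).Adj (some ⟨i, ⟨j.val + 1, hj⟩⟩) (some ⟨i, j⟩) :=
  (starlikeTree_adj_some_some ..).2 ⟨rfl, Or.inr rfl⟩

/-- The depth of a vertex of a starlike tree, i.e. its distance from the centre. -/
def starlikeDepth : Option ((i : Fin k) × Fin (A i)) → ℕ
  | none => 0
  | some ⟨_, j⟩ => j.val + 1

/-- The distance in a starlike tree from the vertex at depth `a + 1` on branch `i`. -/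
def starlikeDistFrom (i : Fin k) (a : ℕ) : Option ((i : Fin k) × Fin (A i)) → ℕ
  | none => a + 1
  | some ⟨i', j⟩ => if i' = i then (a - j.val) + (j.val - a) else (a + 1) + (j.val + 1)

theorem starlikeTree_dist_none (v : Option ((i : Fin k) × Fin (A i))) :
    (starlikeTree k A).dist none v = starlikeDepth v := by
  refine SimpleGraph.dist_eq_of_potential starlikeDepth rfl ?_ ?_ v
  · rintro (_ | ⟨i, j⟩) (_ | ⟨i', j'⟩) h
    · simp
    · rw [starlikeTree_adj_none_some] at h
      simp [starlikeDepth, h]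
    · simp [starlikeDepth]
    · rw [starlikeTree_adj_some_some] at h
      simp only [starlikeDepth]
      omega
  · rintro (_ | ⟨i, j⟩) hv
    · exact absurd rfl hv
    · by_cases hj : j.val = 0
      · exact ⟨none, (starlikeTree_adj_none_some i j).2 hj, by simp [starlikeDepth, hj]⟩
      · exact ⟨_, starlikeTree_adj_pred i j hj, by simp only [starlikeDepth]; omega⟩

theorem starlikeTree_dist_some (i : Fin k) (a : Fin (A i))
    (v : Option ((i : Fin k) × Fin (A i))) :
    (starlikeTree k A).dist (some ⟨i, a⟩) v = starlikeDistFrom i a.val v := by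
  refine SimpleGraph.dist_eq_of_potential (starlikeDistFrom i a.val) ?_ ?_ ?_ v
  · simp [starlikeDistFrom]
  · rintro (_ | ⟨i₁, j₁⟩) (_ | ⟨i₂, j₂⟩) h
    · simp
    · rw [starlikeTree_adj_none_some] at h
      simp only [starlikeDistFrom]
      split_ifs <;> omega
    · rw [SimpleGraph.adj_comm, starlikeTree_adj_none_some] at h
      simp only [starlikeDistFrom]
      split_ifs <;> omega
    · rw [starlikeTree_adj_some_some] at h
      obtain ⟨rfl, h⟩ := h
      simp only [starlikeDistFrom]
      split_ifs <;> omega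
  · rintro (_ | ⟨i', j⟩) hv
    · refine ⟨some ⟨i, ⟨0, a.pos⟩⟩, ?_, ?_⟩
      · rw [SimpleGraph.adj_comm, starlikeTree_adj_none_some]
      · simp [starlikeDistFrom]
    · by_cases hi : i' = i
      · subst hi
        rcases lt_trichotomy j.val a.val with hja | hja | hja
        · refine ⟨_, starlikeTree_adj_succ i' j (by omega), ?_⟩
          simp only [starlikeDistFrom, if_true]
          omega
        · exact absurd (by rw [Fin.ext hja]) hv
        · refine ⟨_, starlikeTree_adj_pred i' j (by omega), ?_⟩
          simp only [starlikeDistFrom, if_true]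
          omega
      · by_cases hj : j.val = 0
        · exact ⟨none, (starlikeTree_adj_none_some i' j).2 hj, by
            simp [starlikeDistFrom, hi, hj]⟩
        · refine ⟨_, starlikeTree_adj_pred i' j hj, ?_⟩
          simp only [starlikeDistFrom, if_neg hi]
          omega

theorem sum_range_two_mul_sub (a n : ℕ) (h : a < n) :
    ∑ j ∈ Finset.range n, 2 * (a - j) = a * (a + 1) := by
  induction n, h using Nat.le_induction with
  | base =>
    have := Finset.sum_range_reflect (fun j => j) (a + 1)
    simp only [Nat.add_sub_cancel] at this
    rw [← Finset.mul_sum, this, mul_comm, Finset.sum_range_id_mul_two, Nat.add_sub_cancel,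
      mul_comm]
  | succ n hn ih =>
    rw [Finset.sum_range_succ, ih]
    omega

theorem sum_range_abs_sub (a n : ℕ) (h : a < n) :
    ∑ j ∈ Finset.range n, ((a - j) + (j - a)) + n * (a + 1) =
      ∑ j ∈ Finset.range n, (j + 1) + a * (a + 1) := by
  rw [← sum_range_two_mul_sub a n h, ← Finset.sum_add_distrib,
    ← smul_eq_mul n, ← Finset.card_range n, ← Finset.sum_const, Finset.card_range,
    ← Finset.sum_add_distrib]
  exact Finset.sum_congr rfl fun j _ => by omega

theorem transmission_starlikeTree_none :
    transmission (starlikeTree k A) none = ∑ i, ∑ j ∈ Finset.range (A i), (j + 1) := by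
  simp only [transmission, starlikeTree_dist_none, Fintype.sum_option, Fintype.sum_sigma,
    starlikeDepth, zero_add]
  exact Finset.sum_congr rfl fun i _ => Fin.sum_univ_eq_sum_range (fun j => j + 1) (A i)

theorem sum_starlikeDistFrom_branch (i : Fin k) (a : Fin (A i)) (i' : Fin k) :
    ∑ j : Fin (A i'), starlikeDistFrom i a.val (some ⟨i', j⟩) +
        (if i' = i then 2 * A i * (a.val + 1) else 0) =
      ∑ j ∈ Finset.range (A i'), (j + 1) + A i' * (a.val + 1) +
        (if i' = i then a.val * (a.val + 1) else 0) := by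
  by_cases hi : i' = i
  · subst hi
    simp only [starlikeDistFrom, if_true]
    rw [Fin.sum_univ_eq_sum_range (fun j => (a.val - j) + (j - a.val)) (A i')]
    linarith [sum_range_abs_sub a.val (A i') a.isLt]
  · simp only [starlikeDistFrom, if_neg hi]
    rw [Fin.sum_univ_eq_sum_range (fun j => (a.val + 1) + (j + 1)) (A i'),
      Finset.sum_add_distrib, Finset.sum_const, Finset.card_range, smul_eq_mul]
    ring

theorem transmission_starlikeTree_some (i : Fin k) (a : Fin (A i)) (c : ℕ)
    (hc : ∑ i, A i = 2 * A i + c) :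
    transmission (starlikeTree k A) (some ⟨i, a⟩) =
      transmission (starlikeTree k A) none + (a.val + 1) * (a.val + 1 + c) := by
  have h := Finset.sum_congr (rfl : (Finset.univ : Finset (Fin k)) = Finset.univ)
    fun i' _ => sum_starlikeDistFrom_branch i a i'
  simp only [Finset.sum_add_distrib, Finset.sum_ite_eq', Finset.mem_univ, if_true,
    ← Finset.sum_mul] at h
  rw [hc] at h
  rw [transmission_starlikeTree_none, transmission]
  simp only [starlikeTree_dist_some, Fintype.sum_option, Fintype.sum_sigma]
  simp only [Finset.sum_add_distrib] at h ⊢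
  have h_none : starlikeDistFrom (A := A) i a.val none = a.val + 1 := rfl
  rw [h_none]
  linarith

end Starlike

/-- If `c < d` and `x (x + c) = y (y + d)`, then `x = y + e` for some positive `e`
with `2 e < d - c`. -/
theorem exists_shift_of_mul_add_eq {x y c d : ℕ} (hy : 0 < y) (hcd : c < d)
    (h : x * (x + c) = y * (y + d)) :
    ∃ e, 0 < e ∧ 2 * e + c < d ∧ x = y + e ∧ 2 * e * y + e * (e + c) + c * y = d * y := by
  have hxy : y < x := by
    by_contra! hle
    have := Nat.mul_le_mul hle (Nat.add_le_add_right hle c)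
    nlinarith
  obtain ⟨e, rfl⟩ := Nat.exists_eq_add_of_lt hxy
  have key : 2 * (e + 1) * y + (e + 1) * (e + 1 + c) + c * y = d * y := by linarith
  refine ⟨e + 1, by omega, ?_, by omega, key⟩
  by_contra! hle
  have := Nat.mul_le_mul_right y hle
  nlinarith

/-- The offsets `c` for which the vertex at depth `p` on a branch of
`X(9 + 12t, 8 + 12t, 5 + 12t, 3)` has transmission `p (p + c)` above that of the centre. -/
def xTreeOffset (t : ℕ) : Fin 4 → ℕ :=
  ![7 + 12 * t, 9 + 12 * t, 15 + 12 * t, 19 + 36 * t]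

theorem xTree_branches_ne {t : ℕ} {i i' : Fin 4} (hi : i < i') {p q : ℕ} (hp : 0 < p)
    (hq : 0 < q) (hq' : q ≤ ![9 + 12 * t, 8 + 12 * t, 5 + 12 * t, 3] i') :
    p * (p + xTreeOffset t i) ≠ q * (q + xTreeOffset t i') := by
  intro h
  have short_branch : ∀ c, 7 + 12 * t ≤ c → p * (p + c) = q * (q + (19 + 36 * t)) → q ≤ 3 →
      p < 9 := by
    intro c hc h hq3
    by_contra! hp9
    have h₁ := Nat.mul_le_mul hp9 (Nat.add_le_add hp9 hc)
    have h₂ := Nat.mul_le_mul hq3 (Nat.add_le_add_right hq3 (19 + 36 * t))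
    omega
  fin_cases i <;> fin_cases i' <;> simp [xTreeOffset] at hi h hq'
  · obtain ⟨e, he, he', -, -⟩ := exists_shift_of_mul_add_eq hq (by omega) h
    omega
  · obtain ⟨e, he, he', -, h_eq⟩ := exists_shift_of_mul_add_eq hq (by omega) h
    have : e < 4 := by omega
    interval_cases e <;> ring_nf at h_eq <;> omega
  · have := short_branch _ (by omega) h hq'
    interval_cases p <;> interval_cases q <;> omega
  · obtain ⟨e, he, he', -, h_eq⟩ := exists_shift_of_mul_add_eq hq (by omega) h
    have : e < 3 := by omega
    interval_cases e <;> ring_nf at h_eq <;> omega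
  · have := short_branch _ (by omega) h hq'
    interval_cases p <;> interval_cases q <;> omega
  · have := short_branch _ (by omega) h hq'
    interval_cases p <;> interval_cases q <;> omega

/-- For every nonnegative integer `t`, the X-tree `X(9+12t, 8+12t, 5+12t, 3)` is
transmission irregular. -/
theorem xTree_family_two_TI (t : ℕ) :
    TransmissionIrregular (starlikeTree 4 ![9 + 12 * t, 8 + 12 * t, 5 + 12 * t, 3]) := by
  have value : ∀ (i : Fin 4) (a : Fin (![9 + 12 * t, 8 + 12 * t, 5 + 12 * t, 3] i)),
      transmission (starlikeTree 4 ![9 + 12 * t, 8 + 12 * t, 5 + 12 * t, 3]) (some ⟨i, a⟩) =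
        transmission (starlikeTree 4 ![9 + 12 * t, 8 + 12 * t, 5 + 12 * t, 3]) none +
          (a.val + 1) * (a.val + 1 + xTreeOffset t i) := by
    intro i a
    refine transmission_starlikeTree_some i a _ ?_
    clear a
    fin_cases i <;> simp [xTreeOffset, Fin.sum_univ_four] <;> ring
  rintro (_ | ⟨i, a⟩) (_ | ⟨i', b⟩) h
  · rfl
  · rw [value] at h
    have : 0 < (b.val + 1) * (b.val + 1 + xTreeOffset t i') := by positivity
    omega
  · rw [value] at h
    have : 0 < (a.val + 1) * (a.val + 1 + xTreeOffset t i) := by positivity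
    omega
  · rw [value, value, Nat.add_left_cancel_iff] at h
    rcases lt_trichotomy i i' with hi | rfl | hi
    · exact absurd h (xTree_branches_ne hi (by omega) (by omega) b.isLt)
    · have hab : a = b := by
        apply Fin.ext
        rcases lt_trichotomy a.val b.val with hlt | heq | hlt
        · nlinarith
        · exact heq
        · nlinarith
      rw [hab]
    · exact absurd h.symm (xTree_branches_ne hi (by omega) (by omega) a.isLt)
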